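/- For every γ ≥ 0 and every fixed s ∈ (0,1), the map r ↦ g^(γ)(s, r) is strictly increasing on (0,1). -/

import Mathlib

open Set

/-- The Hu–Zhang allocation function with parameter `γ`. -/
noncomputable def huZhang (γ s r : ℝ) : ℝ :=
  r * (r / s) ^ γ / (r * (r / s) ^ γ + (1 - r) * ((1 - r) / (1 - s)) ^ γ)

/-- For every `γ ≥ 0` and every fixed `s ∈ (0,1)`, the map `r ↦ g^(γ)(s, r)` is
strictly increasing on `(0,1)`. -/
theorem huZhang_strictMonoOn (γ : ℝ) (hγ : 0 ≤ γ) (s : ℝ) (hs : s ∈ Set.Ioo (0 : ℝ) 1) :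
    StrictMonoOn (fun r => huZhang γ s r) (Set.Ioo (0 : ℝ) 1) := by
  obtain ⟨hs0, hs1⟩ := hs
  rintro a ⟨ha0, ha1⟩ b ⟨hb0, hb1⟩ hab
  have hs1' : 0 < 1 - s := by linarith
  have ha1' : 0 < 1 - a := by linarith
  have hb1' : 0 < 1 - b := by linarith
  have h1 : (a / s) ^ γ ≤ (b / s) ^ γ :=
    Real.rpow_le_rpow (by positivity) (by gcongr) hγ
  have h2 : ((1 - b) / (1 - s)) ^ γ ≤ ((1 - a) / (1 - s)) ^ γ :=
    Real.rpow_le_rpow (by positivity) (by gcongr) hγ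
  have p1 : 0 < (a / s) ^ γ := Real.rpow_pos_of_pos (by positivity) _
  have p2 : 0 < (b / s) ^ γ := Real.rpow_pos_of_pos (by positivity) _
  have p3 : 0 < ((1 - a) / (1 - s)) ^ γ := Real.rpow_pos_of_pos (by positivity) _
  have p4 : 0 < ((1 - b) / (1 - s)) ^ γ := Real.rpow_pos_of_pos (by positivity) _
  have k1 : a * (a / s) ^ γ < b * (b / s) ^ γ :=
    mul_lt_mul hab h1 p1 hb0.le
  have k2 : (1 - b) * ((1 - b) / (1 - s)) ^ γ < (1 - a) * ((1 - a) / (1 - s)) ^ γ :=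
    mul_lt_mul (by linarith) h2 p4 ha1'.le
  have q1 := mul_pos ha0 p1
  have q2 := mul_pos hb0 p2
  have q3 := mul_pos ha1' p3
  have q4 := mul_pos hb1' p4
  simp only [huZhang]
  rw [div_lt_div_iff₀ (add_pos q1 q3) (add_pos q2 q4)]
  have := mul_lt_mul k1 k2.le q4 q2.le
  linarith
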